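/- Let {v_k} be a sequence of nonnegative functions on B₂ ⊂ ℝⁿ, Lipschitz with a constant independent of k, such that for each k there is a bounded measurable g_k with 𝓛v_k = g_k weakly in B₂ ∩ {v_k > 0} and sup_k ‖g_k‖_{L^∞(B₂)} < ∞. Suppose v_k → v uniformly on B₂. Then ∫_{B₁} |∇v_k(x)|²/|x|^{n−2} dx → ∫_{B₁} |∇v(x)|²/|x|^{n−2} dx as k → ∞. -/

import Mathlib

open Set Filter MeasureTheory Metric Bornology
open scoped Topology RealInnerProductSpace ENNReal NNReal

noncomputable section

/-- Euclidean space `ℝⁿ`. -/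
abbrev EucSp (n : ℕ) := EuclideanSpace ℝ (Fin n)

variable {n : ℕ}

/-- Uniform ellipticity of the coefficient field `A` on the set `s`:
`λ|ξ|² ≤ ⟨A(x)ξ, ξ⟩ ≤ Λ|ξ|²`. -/
def IsElliptic (A : EucSp n → (EucSp n →L[ℝ] EucSp n)) (lam Lam : ℝ)
    (s : Set (EucSp n)) : Prop :=
  ∀ x ∈ s, ∀ ξ : EucSp n,
    lam * ‖ξ‖ ^ 2 ≤ ⟪A x ξ, ξ⟫ ∧ ⟪A x ξ, ξ⟫ ≤ Lam * ‖ξ‖ ^ 2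

/-- Symmetry of the coefficient field on `s`. -/
def IsSymmCoeff (A : EucSp n → (EucSp n →L[ℝ] EucSp n)) (s : Set (EucSp n)) : Prop :=
  ∀ x ∈ s, ∀ ξ η : EucSp n, ⟪A x ξ, η⟫ = ⟪ξ, A x η⟫

/-- `A` is Hölder continuous with exponent `γ` and seminorm at most `K` on `s`. -/
def HolderSemi (A : EucSp n → (EucSp n →L[ℝ] EucSp n)) (γ K : ℝ)
    (s : Set (EucSp n)) : Prop :=
  ∀ x ∈ s, ∀ y ∈ s, ‖A x - A y‖ ≤ K * ‖x - y‖ ^ γ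

/-- `v` is locally Lipschitz on the set `s`. -/
def LocLipOn (v : EucSp n → ℝ) (s : Set (EucSp n)) : Prop :=
  ∀ x ∈ s, ∃ K : ℝ≥0, ∃ t ∈ 𝓝[s] x, LipschitzOnWith K v t

/-- A test function for the weak formulation in the open set `D`:
smooth with compact support contained in `D`. -/
def IsTest (D : Set (EucSp n)) (φ : EucSp n → ℝ) : Prop :=
  ContDiff ℝ (⊤ : ℕ∞) φ ∧ HasCompactSupport φ ∧ tsupport φ ⊆ D

/-- `𝓛 v = div(A ∇ v) = f` weakly in `D`:
`∫_D ⟨A(x)∇v, ∇φ⟩ = −∫_D f φ` for every test function `φ`. -/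
def WeakEq (A : EucSp n → (EucSp n →L[ℝ] EucSp n)) (v f : EucSp n → ℝ)
    (D : Set (EucSp n)) : Prop :=
  ∀ φ : EucSp n → ℝ, IsTest D φ →
    ∫ x in D, ⟪A x (gradient v x), gradient φ x⟫ = - ∫ x in D, f x * φ x

/-- `𝓛 v ≥ f` weakly in `D`:
`∫_D ⟨A(x)∇v, ∇φ⟩ ≤ −∫_D f φ` for every nonnegative test function `φ`. -/
def WeakGe (A : EucSp n → (EucSp n →L[ℝ] EucSp n)) (v f : EucSp n → ℝ)
    (D : Set (EucSp n)) : Prop :=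
  ∀ φ : EucSp n → ℝ, IsTest D φ → (∀ x, 0 ≤ φ x) →
    ∫ x in D, ⟪A x (gradient v x), gradient φ x⟫ ≤ - ∫ x in D, f x * φ x

/-- `𝓛 v ≤ f` weakly in `D`:
`∫_D ⟨A(x)∇v, ∇φ⟩ ≥ −∫_D f φ` for every nonnegative test function `φ`. -/
def WeakLe (A : EucSp n → (EucSp n →L[ℝ] EucSp n)) (v f : EucSp n → ℝ)
    (D : Set (EucSp n)) : Prop :=
  ∀ φ : EucSp n → ℝ, IsTest D φ → (∀ x, 0 ≤ φ x) →
    - ∫ x in D, f x * φ x ≤ ∫ x in D, ⟪A x (gradient v x), gradient φ x⟫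

/-- The positive part `v⁺ = max(v, 0)`. -/
def PPart (v : EucSp n → ℝ) : EucSp n → ℝ := fun x => max (v x) 0

/-- The negative part `v⁻ = max(−v, 0)`. -/
def NPart (v : EucSp n → ℝ) : EucSp n → ℝ := fun x => max (-v x) 0

/-- The right-hand side `f·χ_{v<0}`. -/
def ChiNeg (f v : EucSp n → ℝ) : EucSp n → ℝ := fun x => if v x < 0 then f x else 0

/-- `Ω⁺(v) = {x ∈ Ω : v(x) > 0}`. -/
def plusSet (Ω : Set (EucSp n)) (v : EucSp n → ℝ) : Set (EucSp n) :=
  {x ∈ Ω | 0 < v x}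

/-- `Ω⁻(v)` = interior of `{x ∈ Ω : v(x) ≤ 0}`. -/
def minusSet (Ω : Set (EucSp n)) (v : EucSp n → ℝ) : Set (EucSp n) :=
  interior {x ∈ Ω | v x ≤ 0}

/-- The free boundary `F(v) = ∂{v > 0} ∩ Ω`. -/
def freeBdry (Ω : Set (EucSp n)) (v : EucSp n → ℝ) : Set (EucSp n) :=
  frontier (plusSet Ω v) ∩ Ω

/-- `x₀ ∈ F(v)` is regular from the right, via the touching ball `B(y,r) ⊆ Ω⁺(v)`
with `B̄ ∩ F(v) = {x₀}`. -/
def TouchRight (Ω : Set (EucSp n)) (v : EucSp n → ℝ) (x₀ y : EucSp n) (r : ℝ) : Prop :=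
  0 < r ∧ ball y r ⊆ plusSet Ω v ∧ closure (ball y r) ∩ freeBdry Ω v = {x₀}

/-- `x₀ ∈ F(v)` is regular from the left, via the touching ball `B(y,r) ⊆ Ω⁻(v)`
with `B̄ ∩ F(v) = {x₀}`. -/
def TouchLeft (Ω : Set (EucSp n)) (v : EucSp n → ℝ) (x₀ y : EucSp n) (r : ℝ) : Prop :=
  0 < r ∧ ball y r ⊆ minusSet Ω v ∧ closure (ball y r) ∩ freeBdry Ω v = {x₀}

/-- The unit normal at `x₀` to a ball centered at `y` touching `F(v)` from the
right at `x₀`, pointing towards `Ω⁺(v)`, i.e. into the ball. -/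
def nuRight (x₀ y : EucSp n) : EucSp n := ‖y - x₀‖⁻¹ • (y - x₀)

/-- The unit normal at `x₀` to a ball centered at `y` touching `F(v)` from the
left at `x₀`, pointing towards `Ω⁺(v)`, i.e. away from the ball. -/
def nuLeft (x₀ y : EucSp n) : EucSp n := ‖x₀ - y‖⁻¹ • (x₀ - y)

/-- `v(x) ≤ α⟨x − x₀, ν⟩⁺ + o(|x − x₀|)` as `x → x₀` within `s`. -/
def ExpandLe (v : EucSp n → ℝ) (x₀ ν : EucSp n) (α : ℝ) (s : Set (EucSp n)) : Prop :=
  ∀ ε > (0:ℝ), ∀ᶠ x in 𝓝[s] x₀,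
    v x ≤ α * max ⟪x - x₀, ν⟫ 0 + ε * ‖x - x₀‖

/-- `v(x) ≥ α⟨x − x₀, ν⟩⁺ + o(|x − x₀|)` as `x → x₀` within `s`. -/
def ExpandGe (v : EucSp n → ℝ) (x₀ ν : EucSp n) (α : ℝ) (s : Set (EucSp n)) : Prop :=
  ∀ ε > (0:ℝ), ∀ᶠ x in 𝓝[s] x₀,
    α * max ⟪x - x₀, ν⟫ 0 - ε * ‖x - x₀‖ ≤ v x

/-- `v(x) = o(|x − x₀|)` as `x → x₀` within `s`. -/
def SmallO (v : EucSp n → ℝ) (x₀ : EucSp n) (s : Set (EucSp n)) : Prop :=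
  ∀ ε > (0:ℝ), ∀ᶠ x in 𝓝[s] x₀, |v x| ≤ ε * ‖x - x₀‖

/-- The non-tangential cone at `x₀` in direction `ν` with opening parameter `θ`. -/
def ntCone (x₀ ν : EucSp n) (θ : ℝ) : Set (EucSp n) :=
  {x | θ * ‖x - x₀‖ < ⟪x - x₀, ν⟫}

/-- Hypotheses on the free boundary condition function `G(β, x, ν)`: strictly
increasing in `β ≥ 0`, Lipschitz in all arguments, and
`G(0) := inf_{x ∈ Ω, |ν|=1} G(0, x, ν) ≥ G0 > 0`. -/
def GHyp (Ω : Set (EucSp n)) (G : ℝ → EucSp n → EucSp n → ℝ) (G0 : ℝ) : Prop :=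
  (∀ x ν, StrictMonoOn (fun β => G β x ν) (Ici (0:ℝ))) ∧
  (∃ LG : ℝ≥0, LipschitzWith LG (fun p : ℝ × EucSp n × EucSp n => G p.1 p.2.1 p.2.2)) ∧
  0 < G0 ∧ ∀ x ∈ Ω, ∀ ν : EucSp n, ‖ν‖ = 1 → G0 ≤ G 0 x ν

/-- A (crude) notion of bounded Lipschitz domain: bounded, open, and near every
boundary point, `Ω` is the supergraph of a Lipschitz function in some direction. -/
def IsLipschitzDomain (Ω : Set (EucSp n)) : Prop :=
  IsOpen Ω ∧ IsBounded Ω ∧ Ω.Nonempty ∧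
  ∀ x ∈ frontier Ω, ∃ r : ℝ, 0 < r ∧ ∃ (g : EucSp n → ℝ) (L : ℝ≥0) (e : EucSp n),
    ‖e‖ = 1 ∧ LipschitzWith L g ∧
    ∀ y ∈ ball x r, (y ∈ Ω ↔ g (y - ⟪y, e⟫ • e) < ⟪y, e⟫)

/-- The class `𝓕` of admissible supersolutions (Definition 1.2). -/
def memF (A : EucSp n → (EucSp n →L[ℝ] EucSp n)) (Ω : Set (EucSp n))
    (f₁ f₂ : EucSp n → ℝ) (G : ℝ → EucSp n → EucSp n → ℝ) (w : EucSp n → ℝ) : Prop :=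
  ContinuousOn w (closure Ω) ∧ LocLipOn w (closure Ω) ∧
  WeakLe A w f₁ (plusSet Ω w) ∧
  WeakLe A w (ChiNeg f₂ w) (minusSet Ω w) ∧
  (∀ x₀ y r, TouchLeft Ω w x₀ y r →
    ∃ α β : ℝ, 0 ≤ α ∧ 0 ≤ β ∧
      ExpandLe (PPart w) x₀ (nuLeft x₀ y) α Set.univ ∧
      ExpandGe (NPart w) x₀ (-(nuLeft x₀ y)) β Set.univ ∧
      α < G β x₀ (nuLeft x₀ y)) ∧
  (∀ x₀ ∈ freeBdry Ω w, (∀ y r, ¬ TouchLeft Ω w x₀ y r) → SmallO w x₀ Set.univ)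

/-- A minorant (strict subsolution) for the free boundary problem. -/
def IsMinorant (A : EucSp n → (EucSp n →L[ℝ] EucSp n)) (Ω : Set (EucSp n))
    (f₁ f₂ : EucSp n → ℝ) (G : ℝ → EucSp n → EucSp n → ℝ) (u : EucSp n → ℝ) : Prop :=
  LocLipOn u Ω ∧
  WeakGe A u f₁ (plusSet Ω u) ∧
  WeakGe A u (ChiNeg f₂ u) (minusSet Ω u) ∧
  ∀ x₀ ∈ freeBdry Ω u, ∃ y r, TouchRight Ω u x₀ y r ∧
    ∃ α β : ℝ, 0 ≤ α ∧ 0 ≤ β ∧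
      ExpandGe (PPart u) x₀ (nuRight x₀ y) α Set.univ ∧
      ExpandLe (NPart u) x₀ (-(nuRight x₀ y)) β Set.univ ∧
      G β x₀ (nuRight x₀ y) < α

/-- A weak solution of the two-phase free boundary problem (Definition 1.1). -/
def IsWeakSolution (A : EucSp n → (EucSp n →L[ℝ] EucSp n)) (Ω : Set (EucSp n))
    (f₁ f₂ : EucSp n → ℝ) (G : ℝ → EucSp n → EucSp n → ℝ) (u : EucSp n → ℝ) : Prop :=
  ContinuousOn u Ω ∧
  WeakEq A u f₁ (plusSet Ω u) ∧
  WeakEq A u (ChiNeg f₂ u) (minusSet Ω u) ∧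
  (∀ x₀ y r, TouchRight Ω u x₀ y r →
    ∃ α β : ℝ, 0 ≤ α ∧ 0 ≤ β ∧
      ExpandGe (PPart u) x₀ (nuRight x₀ y) α (ball y r) ∧
      ExpandLe (NPart u) x₀ (-(nuRight x₀ y)) β (closure (ball y r))ᶜ ∧
      (∀ θ ∈ Ioo (0:ℝ) 1,
        SmallO (fun x => PPart u x - α * ⟪x - x₀, nuRight x₀ y⟫) x₀
          (ntCone x₀ (nuRight x₀ y) θ) ∧
        SmallO (fun x => NPart u x - β * ⟪x - x₀, -(nuRight x₀ y)⟫) x₀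
          (ntCone x₀ (-(nuRight x₀ y)) θ)) ∧
      α ≤ G β x₀ (nuRight x₀ y)) ∧
  (∀ x₀ y r, TouchLeft Ω u x₀ y r →
    ∃ α β : ℝ, 0 ≤ α ∧ 0 ≤ β ∧
      ExpandGe (NPart u) x₀ (-(nuLeft x₀ y)) β (ball y r) ∧
      ExpandLe (PPart u) x₀ (nuLeft x₀ y) α (closure (ball y r))ᶜ ∧
      (∀ θ ∈ Ioo (0:ℝ) 1,
        SmallO (fun x => PPart u x - α * ⟪x - x₀, nuLeft x₀ y⟫) x₀
          (ntCone x₀ (nuLeft x₀ y) θ) ∧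
        SmallO (fun x => NPart u x - β * ⟪x - x₀, -(nuLeft x₀ y)⟫) x₀
          (ntCone x₀ (-(nuLeft x₀ y)) θ)) ∧
      G β x₀ (nuLeft x₀ y) ≤ α)

/-- The Perron family: admissible supersolutions above the minorant `ubar`
with boundary values `φb`. -/
def PerronFam (A : EucSp n → (EucSp n →L[ℝ] EucSp n)) (Ω : Set (EucSp n))
    (f₁ f₂ : EucSp n → ℝ) (G : ℝ → EucSp n → EucSp n → ℝ)
    (ubar φb : EucSp n → ℝ) : Set (EucSp n → ℝ) :=
  {w | memF A Ω f₁ f₂ G w ∧ (∀ x ∈ closure Ω, ubar x ≤ w x) ∧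
       ∀ x ∈ frontier Ω, w x = φb x}


section GradientTools

variable {E : Type*} [NormedAddCommGroup E] [InnerProductSpace ℝ E] [FiniteDimensional ℝ E]

theorem norm_gradient_eq_norm_fderiv (f : E → ℝ) (x : E) : ‖gradient f x‖ = ‖fderiv ℝ f x‖ := by
  simp [gradient]

theorem LipschitzWith.norm_gradient_le {f : E → ℝ} {C : ℝ≥0} (hf : LipschitzWith C f) (x : E) :
    ‖gradient f x‖ ≤ C := by
  rw [norm_gradient_eq_norm_fderiv]
  exact norm_fderiv_le_of_lipschitz ℝ hf

theorem gradient_fun_mul {f g : E → ℝ} {x : E} (hf : DifferentiableAt ℝ f x)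
    (hg : DifferentiableAt ℝ g x) :
    gradient (fun y => f y * g y) x = f x • gradient g x + g x • gradient f x := by
  simp [gradient, fderiv_fun_mul hf hg]

theorem gradient_fun_sub {f g : E → ℝ} {x : E} (hf : DifferentiableAt ℝ f x)
    (hg : DifferentiableAt ℝ g x) :
    gradient (fun y => f y - g y) x = gradient f x - gradient g x := by
  simp [gradient, fderiv_fun_sub hf hg]

theorem gradient_eq_zero_of_isLocalMin {f : E → ℝ} {x : E} (h : IsLocalMin f x) :
    gradient f x = 0 := by
  simp [gradient, h.fderiv_eq_zero]

theorem gradient_eq_zero_of_notMem_tsupport {f : E → ℝ} {x : E} (h : x ∉ tsupport f) :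
    gradient f x = 0 := by
  rw [(notMem_tsupport_iff_eventuallyEq.1 h).gradient_eq]
  exact gradient_const x 0

/-- The gradient of a nonnegative function is unaffected by a small truncation from below. -/
theorem tendsto_gradient_max_sub_zero {f : E → ℝ} {x : E} (hf : ContinuousAt f x)
    (hnn : ∀ᶠ y in 𝓝 x, 0 ≤ f y) :
    Tendsto (fun ε : ℝ => gradient (fun y => max (f y - ε) 0) x) (𝓝[>] 0)
      (𝓝 (gradient f x)) := by
  refine tendsto_const_nhds.congr' ?_
  rcases hnn.self_of_nhds.eq_or_lt with h0 | hpos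
  · filter_upwards [self_mem_nhdsWithin] with ε hε
    rw [gradient_eq_zero_of_isLocalMin (f := f) (by filter_upwards [hnn] with y hy; rwa [← h0])]
    have : (fun y => max (f y - ε) 0) =ᶠ[𝓝 x] fun _ => 0 := by
      filter_upwards [hf.eventually (gt_mem_nhds (h0 ▸ hε : f x < ε))] with y hy
      exact max_eq_right (by linarith)
    rw [this.gradient_eq, gradient_fun_const]
  · filter_upwards [mem_nhdsWithin_of_mem_nhds (gt_mem_nhds (half_pos hpos)),
      self_mem_nhdsWithin] with ε hε hε0
    have : (fun y => max (f y - ε) 0) =ᶠ[𝓝 x] fun y => f y - ε := by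
      filter_upwards [hf.eventually (lt_mem_nhds (half_lt_self hpos))] with y hy
      exact max_eq_left (by have : ε < f x / 2 := hε; linarith)
    rw [this.gradient_eq]
    simp [gradient, fderiv_sub_const]

theorem LipschitzWith.max_sub_const {X : Type*} [PseudoEMetricSpace X] {f : X → ℝ} {C : ℝ≥0}
    (hf : LipschitzWith C f) (ε : ℝ) : LipschitzWith C (fun y => max (f y - ε) 0) := by
  have : LipschitzWith C (fun y => f y - ε) := by
    intro x y; simpa using hf x y
  exact this.max_const 0

/-- The product of a cutoff supported in `Ω` with a Lipschitz function bounded on `Ω`. -/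
theorem LipschitzWith.cutoff_mul {X : Type*} [PseudoMetricSpace X] {η u : X → ℝ} {Ω : Set X}
    {C L S : ℝ≥0} (hη : LipschitzWith C η) (hη1 : ∀ x, |η x| ≤ 1) (hη0 : ∀ x ∉ Ω, η x = 0)
    (hu : LipschitzWith L u) (hS : ∀ x ∈ Ω, |u x| ≤ S) :
    LipschitzWith (C * S + L) (fun x => η x * u x) := by
  have key : ∀ x y, x ∈ Ω → dist (η x * u x) (η y * u y) ≤ (C * S + L) * dist x y := by
    intro x y hx
    have h1 := hη.dist_le_mul x y
    have h2 := hu.dist_le_mul x y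
    rw [Real.dist_eq] at h1 h2 ⊢
    calc |η x * u x - η y * u y| = |(η x - η y) * u x + η y * (u x - u y)| := by ring_nf
      _ ≤ |η x - η y| * |u x| + |η y| * |u x - u y| := by
        rw [← abs_mul, ← abs_mul]; exact abs_add_le _ _
      _ ≤ (C * dist x y) * S + 1 * (L * dist x y) := by
        gcongr
        · exact hS x hx
        · exact hη1 y
      _ = _ := by ring
  refine LipschitzWith.of_dist_le_mul fun x y => ?_
  push_cast
  by_cases hx : x ∈ Ω
  · exact key x y hx
  by_cases hy : y ∈ Ω
  · rw [dist_comm, dist_comm x y]; exact key y x hy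
  · simp only [hη0 x hx, hη0 y hy, zero_mul, dist_self]; positivity

variable [MeasurableSpace E] [BorelSpace E]

theorem measurable_gradient (f : E → ℝ) : Measurable (gradient f) :=
  (InnerProductSpace.toDual ℝ E).symm.continuous.measurable.comp (measurable_fderiv ℝ f)

theorem integrable_inner_gradient {F : E → E} (hF : Integrable F) {f : E → ℝ} {C : ℝ≥0}
    (hf : LipschitzWith C f) : Integrable (fun x => ⟪F x, gradient f x⟫) := by
  refine (hF.norm.mul_const (C : ℝ)).mono'
    (hF.1.inner (measurable_gradient f).aestronglyMeasurable) (.of_forall fun x => ?_)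
  exact (norm_inner_le_norm _ _).trans (by gcongr; exact hf.norm_gradient_le x)

theorem abs_integral_inner_gradient_le {F : E → E} (hF : Integrable F) {f : E → ℝ} {C : ℝ≥0}
    (hf : LipschitzWith C f) : |∫ x, ⟪F x, gradient f x⟫| ≤ C * ∫ x, ‖F x‖ := by
  rw [← integral_const_mul, ← Real.norm_eq_abs]
  refine norm_integral_le_of_norm_le (hF.norm.const_mul _) (.of_forall fun x => ?_)
  rw [mul_comm]
  exact (norm_inner_le_norm _ _).trans (by gcongr; exact hf.norm_gradient_le x)

/-- Uniformly Lipschitz functions tending uniformly to zero have gradients tending weakly to zero,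
tested against a compactly supported smooth field. -/
theorem tendsto_integral_inner_gradient_of_contDiff {G : E → E} (hG : ContDiff ℝ 1 G)
    (hGc : HasCompactSupport G) {ψ : ℕ → E → ℝ} {C : ℝ≥0} (hψ : ∀ k, LipschitzWith C (ψ k))
    (h0 : TendstoUniformly ψ 0 atTop) :
    Tendsto (fun k => ∫ x, ⟪G x, gradient (ψ k) x⟫) atTop (𝓝 0) := by
  let b := stdOrthonormalBasis ℝ E
  have hGi : ∀ i, ContDiff ℝ 1 (fun x => ⟪G x, b i⟫) := fun i => hG.inner ℝ contDiff_const
  have hGic : ∀ i, HasCompactSupport (fun x => ⟪G x, b i⟫) := fun i =>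
    hGc.comp_left (g := fun y : E => ⟪y, b i⟫) (inner_zero_left _)
  choose D hD using fun i => (hGi i).lipschitzWith_of_hasCompactSupport (hGic i) one_ne_zero
  have hint : ∀ i k, Integrable (fun x => lineDeriv ℝ (ψ k) x (b i) * ⟪G x, b i⟫) := fun i k =>
    (((hGi i).continuous.integrable_of_hasCompactSupport (hGic i)).bdd_mul
      (aestronglyMeasurable_lineDeriv (hψ k).continuous _)
      (.of_forall fun x => norm_lineDeriv_le_of_lipschitz ℝ (hψ k)))
  have hsum : ∀ k, ∫ x, ⟪G x, gradient (ψ k) x⟫ =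
      ∑ i, ∫ x, lineDeriv ℝ (⟪G ·, b i⟫) x (-b i) * ψ k x := by
    intro k
    simp_rw [← fun i => (hψ k).integral_lineDeriv_mul_eq (μ := volume) (hD i) (hGic i) (b i)]
    rw [← integral_finsetSum _ fun i _ => hint i k]
    refine integral_congr_ae ?_
    filter_upwards [(hψ k).ae_differentiableAt (μ := volume)] with x hx
    rw [← b.sum_inner_mul_inner]
    refine Finset.sum_congr rfl fun i _ => ?_
    rw [hx.lineDeriv_eq_fderiv, ← inner_gradient_left, real_inner_comm (b i) (gradient _ x),
      mul_comm]
  simp_rw [hsum]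
  rw [show (0 : ℝ) = ∑ i : Fin (Module.finrank ℝ E), 0 by simp]
  refine tendsto_finsetSum _ fun i _ => ?_
  have hH : Integrable (fun x => lineDeriv ℝ (⟪G ·, b i⟫) x (-b i)) := by
    have : (fun x => lineDeriv ℝ (⟪G ·, b i⟫) x (-b i)) =
        fun x => fderiv ℝ (⟪G ·, b i⟫) x (-b i) := by
      ext x
      exact ((hGi i).differentiable one_ne_zero x).lineDeriv_eq_fderiv
    rw [this]
    exact (((hGi i).continuous_fderiv one_ne_zero).clm_apply
      continuous_const).integrable_of_hasCompactSupport ((hGic i).fderiv_apply ℝ _)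
  set H := fun x => lineDeriv ℝ (⟪G ·, b i⟫) x (-b i)
  have hI : 0 ≤ ∫ x, ‖H x‖ := integral_nonneg fun _ => norm_nonneg _
  rw [Metric.tendsto_atTop']
  intro ε hε
  obtain ⟨N, hN⟩ := eventually_atTop.1
    (Metric.tendstoUniformly_iff.1 h0 (ε / (1 + ∫ x, ‖H x‖)) (by positivity))
  refine ⟨N, fun k hk => ?_⟩
  rw [dist_zero_right]
  refine (norm_integral_le_of_norm_le (hH.norm.mul_const (ε / (1 + ∫ x, ‖H x‖)))
    (.of_forall fun x => ?_)).trans_lt ?_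
  · rw [norm_mul]
    have := (hN k hk.le x).le
    rw [Pi.zero_apply, dist_zero_left] at this
    gcongr
  · rw [integral_mul_const, ← mul_div_assoc, div_lt_iff₀ (by positivity)]
    nlinarith

/-- Uniformly Lipschitz functions tending uniformly to zero have gradients tending weakly to zero,
tested against an integrable field. -/
theorem tendsto_integral_inner_gradient {F : E → E} (hF : Integrable F) {ψ : ℕ → E → ℝ}
    {C : ℝ≥0} (hψ : ∀ k, LipschitzWith C (ψ k)) (h0 : TendstoUniformly ψ 0 atTop) :
    Tendsto (fun k => ∫ x, ⟪F x, gradient (ψ k) x⟫) atTop (𝓝 0) := by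
  rw [Metric.tendsto_atTop']
  intro ε hε
  set δ := ε / (2 * (C + 1)) with hδ
  have hδ0 : 0 < δ := by positivity
  obtain ⟨G, hGc, hG, hFG⟩ := (memLp_one_iff_integrable.2 hF).exist_eLpNorm_sub_le
    ENNReal.one_ne_top le_rfl hδ0
  have hGi : Integrable G := hG.continuous.integrable_of_hasCompactSupport hGc
  have hFG' : ∫ x, ‖(F - G) x‖ ≤ δ := by
    rw [integral_norm_eq_lintegral_enorm (hF.sub hGi).1, ← eLpNorm_one_eq_lintegral_enorm]
    exact ENNReal.toReal_le_of_le_ofReal hδ0.le hFG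
  obtain ⟨N, hN⟩ := Metric.tendsto_atTop'.1 (tendsto_integral_inner_gradient_of_contDiff
    (hG.of_le (by simp)) hGc hψ h0) (ε / 2) (half_pos hε)
  refine ⟨N, fun k hk => ?_⟩
  have h1 := hN k hk
  have h2 := abs_integral_inner_gradient_le (hF.sub hGi) (hψ k)
  rw [dist_zero_right, Real.norm_eq_abs] at h1 ⊢
  have h3 : ∫ x, ⟪F x, gradient (ψ k) x⟫ =
      (∫ x, ⟪(F - G) x, gradient (ψ k) x⟫) + ∫ x, ⟪G x, gradient (ψ k) x⟫ := by
    rw [← integral_add (integrable_inner_gradient (hF.sub hGi) (hψ k))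
      (integrable_inner_gradient hGi (hψ k))]
    simp
  rw [h3]
  calc _ ≤ |∫ x, ⟪(F - G) x, gradient (ψ k) x⟫| + |∫ x, ⟪G x, gradient (ψ k) x⟫| := abs_add_le _ _
    _ < C * δ + ε / 2 := add_lt_add_of_le_of_lt (h2.trans (by gcongr)) h1
    _ ≤ ε := by
      have : (C + 1 : ℝ) * δ = ε / 2 := by rw [hδ]; field_simp
      linarith

/-- A compactly supported Lipschitz function is uniformly approximated by smooth functions with
the same Lipschitz constant and support in a prescribed neighbourhood. -/
theorem LipschitzWith.exists_contDiff_approx {φ : E → ℝ} {C : ℝ≥0} (hφ : LipschitzWith C φ)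
    (hc : HasCompactSupport φ) {U : Set E} (hU : IsOpen U) (hφU : tsupport φ ⊆ U) {ε : ℝ}
    (hε : 0 < ε) :
    ∃ ψ : E → ℝ, ContDiff ℝ (⊤ : ℕ∞) ψ ∧ LipschitzWith C ψ ∧ HasCompactSupport ψ ∧
      tsupport ψ ⊆ U ∧ ∀ x, |ψ x - φ x| ≤ ε := by
  obtain ⟨r, hr, hrU⟩ := hc.isCompact.exists_cthickening_subset_open hU hφU
  set s := min r (ε / (C + 1)) with hs
  have hs0 : 0 < s := by positivity
  let ρ : ContDiffBump (0 : E) := ⟨s / 2, s, half_pos hs0, half_lt_self hs0⟩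
  have hloc : LocallyIntegrable φ (volume : Measure E) := hφ.continuous.locallyIntegrable
  set ψ : E → ℝ := convolution (ρ.normed volume) φ (ContinuousLinearMap.lsmul ℝ ℝ) volume with hψ
  have hsupp : Function.support ψ ⊆ cthickening r (tsupport φ) := by
    refine (support_convolution_subset _).trans ?_
    rw [ρ.support_normed_eq]
    rintro _ ⟨a, ha, b, hb, rfl⟩
    refine mem_cthickening_of_dist_le _ b _ _ (subset_tsupport _ hb) ?_
    rw [mem_ball_zero_iff] at ha
    simpa using ha.le.trans (min_le_left _ _)
  have hts : tsupport ψ ⊆ cthickening r (tsupport φ) :=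
    closure_minimal hsupp isClosed_cthickening
  refine ⟨ψ, ρ.hasCompactSupport_normed.contDiff_convolution_left _ ρ.contDiff_normed hloc, ?_,
    hc.isCompact.cthickening.of_isClosed_subset (isClosed_tsupport _) hts, hts.trans hrU, ?_⟩
  · refine LipschitzWith.of_dist_le_mul fun x y => ?_
    have hi : ∀ z, Integrable (fun t => ρ.normed volume t * φ (z - t)) := fun z =>
      (ρ.continuous_normed.mul (hφ.continuous.comp (continuous_const.sub continuous_id))
        ).integrable_of_hasCompactSupport ρ.hasCompactSupport_normed.mul_right
    have hd : ψ x - ψ y = ∫ t, ρ.normed volume t * (φ (x - t) - φ (y - t)) := by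
      simp only [hψ, convolution, ContinuousLinearMap.lsmul_apply, smul_eq_mul, mul_sub]
      rw [integral_sub (hi x) (hi y)]
    rw [Real.dist_eq, hd, ← Real.norm_eq_abs]
    refine (norm_integral_le_of_norm_le (ρ.integrable_normed.mul_const (C * dist x y))
      (.of_forall fun t => ?_)).trans ?_
    · rw [norm_mul, Real.norm_of_nonneg (ρ.nonneg_normed t), ← dist_eq_norm]
      have := hφ.dist_le_mul (x - t) (y - t)
      rw [dist_sub_right] at this
      gcongr
      exact ρ.nonneg_normed t
    · rw [integral_mul_const, ρ.integral_normed, one_mul]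
  · intro x
    rw [← Real.dist_eq]
    refine ρ.dist_normed_convolution_le hφ.continuous.aestronglyMeasurable fun y hy => ?_
    refine (hφ.dist_le_mul y x).trans ?_
    have h1 : dist y x ≤ ε / (C + 1) := (mem_ball.1 hy).le.trans (min_le_right _ _)
    calc (C : ℝ) * dist y x ≤ (C + 1) * (ε / (C + 1)) := by gcongr; linarith
      _ = ε := by field_simp

theorem abs_integral_inner_gradient_le_of_approx {F : E → E} (hF : Integrable F) {φ : E → ℝ}
    {C : ℝ≥0} (hφ : LipschitzWith C φ) {M S : ℝ}
    (h : ∀ ε > 0, ∃ ψ : E → ℝ, LipschitzWith C ψ ∧ (∀ x, |ψ x - φ x| ≤ ε) ∧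
      |∫ x, ⟪F x, gradient ψ x⟫| ≤ M * (S + ε)) :
    |∫ x, ⟪F x, gradient φ x⟫| ≤ M * S := by
  choose ψ hψ hψφ hψM using fun j : ℕ => h (1 / ((j : ℝ) + 1)) (by positivity)
  have hu : TendstoUniformly (fun j x => ψ j x - φ x) 0 atTop := by
    rw [Metric.tendstoUniformly_iff]
    intro ε hε
    filter_upwards [tendsto_one_div_add_atTop_nhds_zero_nat.eventually (gt_mem_nhds hε)]
      with j hj x
    rw [Pi.zero_apply, dist_zero_left]
    exact (hψφ j x).trans_lt hj
  have hlim := tendsto_integral_inner_gradient hF (fun j => (hψ j).sub hφ) hu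
  have heq : ∀ j, ∫ x, ⟪F x, gradient (fun y => ψ j y - φ y) x⟫ =
      (∫ x, ⟪F x, gradient (ψ j) x⟫) - ∫ x, ⟪F x, gradient φ x⟫ := by
    intro j
    rw [← integral_sub (integrable_inner_gradient hF (hψ j)) (integrable_inner_gradient hF hφ)]
    refine integral_congr_ae ?_
    filter_upwards [(hψ j).ae_differentiableAt, hφ.ae_differentiableAt] with x h1 h2
    rw [gradient_fun_sub h1 h2, inner_sub_right]
  simp_rw [heq] at hlim
  have hlim' : Tendsto (fun j => ∫ x, ⟪F x, gradient (ψ j) x⟫) atTop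
      (𝓝 (∫ x, ⟪F x, gradient φ x⟫)) := by
    simpa using hlim.add_const (∫ x, ⟪F x, gradient φ x⟫)
  refine le_of_tendsto_of_tendsto' hlim'.abs ?_ hψM
  simpa using (tendsto_one_div_add_atTop_nhds_zero_nat (𝕜 := ℝ)).const_add S |>.const_mul M

/-- A bound for smooth functions supported in the positivity set of `w` extends to nonnegative
Lipschitz functions that merely vanish wherever `w` does. -/
theorem abs_integral_inner_gradient_le_of_posSet {F : E → E} (hF : Integrable F) {Ω : Set E}
    (hΩ : IsOpen Ω) {w : E → ℝ} (hw : Continuous w) {M : ℝ} (hM : 0 ≤ M)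
    (htest : ∀ ψ : E → ℝ, ContDiff ℝ (⊤ : ℕ∞) ψ → HasCompactSupport ψ →
      tsupport ψ ⊆ Ω ∩ {x | 0 < w x} → ∀ S, (∀ x, |ψ x| ≤ S) →
        |∫ x, ⟪F x, gradient ψ x⟫| ≤ M * S)
    {φ : E → ℝ} {C : ℝ≥0} (hφ : LipschitzWith C φ) (hc : HasCompactSupport φ)
    (hφΩ : tsupport φ ⊆ Ω) (hφ0 : ∀ x, 0 ≤ φ x) (hφw : ∀ x, 0 < φ x → 0 < w x)
    {S : ℝ} (hφS : ∀ x, φ x ≤ S) :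
    |∫ x, ⟪F x, gradient φ x⟫| ≤ M * S := by
  refine abs_integral_inner_gradient_le_of_approx hF hφ fun ε hε => ?_
  set ψ : E → ℝ := fun y => max (φ y - ε) 0
  have hψ : LipschitzWith C ψ := hφ.max_sub_const ε
  have hψ0 : ∀ x, 0 ≤ ψ x := fun x => le_max_right _ _
  have hsupp : Function.support ψ ⊆ tsupport φ ∩ {x | ε ≤ φ x} := by
    intro x hx
    have hx' : ε ≤ φ x := by
      by_contra hlt
      exact hx (max_eq_right (by linarith))
    exact ⟨subset_tsupport _ (hε.trans_le hx').ne', hx'⟩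
  have hts : tsupport ψ ⊆ tsupport φ ∩ {x | ε ≤ φ x} :=
    closure_minimal hsupp
      ((isClosed_tsupport _).inter (isClosed_le continuous_const hφ.continuous))
  have hψc : HasCompactSupport ψ :=
    hc.isCompact.of_isClosed_subset (isClosed_tsupport _) (hts.trans inter_subset_left)
  have hψU : tsupport ψ ⊆ Ω ∩ {x | 0 < w x} := fun x hx =>
    ⟨hφΩ (hts hx).1, hφw x (hε.trans_le (hts hx).2)⟩
  have hψS : ∀ x, |ψ x| ≤ S := fun x => by
    rw [abs_of_nonneg (hψ0 x)]
    exact max_le (by linarith [hφS x]) ((hφ0 x).trans (hφS x))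
  refine ⟨ψ, hψ, fun x => ?_, ?_⟩
  · rw [abs_le]
    constructor
    · linarith [le_max_left (φ x - ε) 0]
    · linarith [max_le (by linarith : φ x - ε ≤ φ x) (hφ0 x)]
  · refine (?_ : _ ≤ M * S).trans (by gcongr; linarith)
    refine abs_integral_inner_gradient_le_of_approx hF hψ fun δ hδ => ?_
    obtain ⟨ρ, hρ, hρL, hρc, hρU, hρψ⟩ := hψ.exists_contDiff_approx hψc
      (hΩ.inter (isOpen_lt continuous_const hw)) hψU hδ
    refine ⟨ρ, hρL, hρψ, htest ρ hρ hρc hρU _ fun x => ?_⟩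
    calc |ρ x| = |ψ x + (ρ x - ψ x)| := by ring_nf
      _ ≤ |ψ x| + |ρ x - ψ x| := abs_add_le _ _
      _ ≤ S + δ := add_le_add (hψS x) (hρψ x)

theorem integral_inner_gradient_mul {F : E → E} (hF : Integrable F) {Ω : Set E}
    (hF0 : ∀ x ∉ Ω, F x = 0) {η u : E → ℝ} {C L : ℝ≥0} (hη : LipschitzWith C η)
    (hη1 : ∀ x, |η x| ≤ 1) (hu : LipschitzWith L u) {S : ℝ} (hS : ∀ x ∈ Ω, |u x| ≤ S) :
    ∫ x, ⟪F x, gradient (fun y => η y * u y) x⟫ =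
      (∫ x, η x * ⟪F x, gradient u x⟫) + ∫ x, u x * ⟪F x, gradient η x⟫ := by
  rw [← integral_add]
  · refine integral_congr_ae ?_
    filter_upwards [hη.ae_differentiableAt, hu.ae_differentiableAt] with x h1 h2
    rw [gradient_fun_mul h1 h2, inner_add_right, inner_smul_right, inner_smul_right]
  · exact (integrable_inner_gradient hF hu).bdd_mul hη.continuous.aestronglyMeasurable
      (.of_forall hη1)
  · refine ((integrable_inner_gradient hF hη).norm.const_mul S).mono'
      (hu.continuous.aestronglyMeasurable.mul (integrable_inner_gradient hF hη).1)
      (.of_forall fun x => ?_)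
    by_cases hx : x ∈ Ω
    · rw [norm_mul]
      gcongr
      exact hS x hx
    · simp [hF0 x hx]

theorem abs_integral_mul_inner_gradient_le {F : E → E} (hF : Integrable F) {Ω : Set E}
    (hF0 : ∀ x ∉ Ω, F x = 0) {η u : E → ℝ} {C : ℝ≥0} (hη : LipschitzWith C η)
    {S : ℝ} (hS : ∀ x ∈ Ω, |u x| ≤ S) :
    |∫ x, u x * ⟪F x, gradient η x⟫| ≤ S * (C * ∫ x, ‖F x‖) := by
  rw [← integral_const_mul, ← integral_const_mul, ← Real.norm_eq_abs]
  refine norm_integral_le_of_norm_le ((hF.norm.const_mul _).const_mul _) (.of_forall fun x => ?_)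
  by_cases hx : x ∈ Ω
  · rw [norm_mul, mul_comm (C : ℝ)]
    have h0 := (norm_nonneg (u x)).trans (hS x hx)
    refine mul_le_mul (hS x hx) ((norm_inner_le_norm _ _).trans ?_) (norm_nonneg _) h0
    gcongr
    exact hη.norm_gradient_le x
  · simp [hF0 x hx]

/-- Testing with `η (w - (v - ε)⁺)`, which vanishes wherever `w` does. -/
theorem abs_integral_cutoff_mul_inner_gradient_sub_le {F : E → E} (hF : Integrable F) {Ω : Set E}
    (hΩ : IsOpen Ω) (hF0 : ∀ x ∉ Ω, F x = 0) {M : ℝ} (hM : 0 ≤ M)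
    {η w v : E → ℝ} {C L : ℝ≥0} (hη : LipschitzWith C η) (hηc : HasCompactSupport η)
    (hηΩ : tsupport η ⊆ Ω) (hη0 : ∀ x, 0 ≤ η x) (hη1 : ∀ x, η x ≤ 1)
    (hw : LipschitzWith L w) (hv : LipschitzWith L v) (hwnn : ∀ x ∈ Ω, 0 ≤ w x)
    (htest : ∀ ψ : E → ℝ, ContDiff ℝ (⊤ : ℕ∞) ψ → HasCompactSupport ψ →
      tsupport ψ ⊆ Ω ∩ {x | 0 < w x} → ∀ S, (∀ x, |ψ x| ≤ S) →
        |∫ x, ⟪F x, gradient ψ x⟫| ≤ M * S)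
    {ε : ℝ} (hε : 0 ≤ ε) (hwv : ∀ x ∈ Ω, |w x - v x| ≤ ε) :
    |∫ x, η x * ⟪F x, gradient w x - gradient (fun y => max (v y - ε) 0) x⟫| ≤
      2 * ε * (M + C * ∫ x, ‖F x‖) := by
  set h : E → ℝ := fun y => max (v y - ε) 0
  have hh : LipschitzWith L h := hv.max_sub_const ε
  have hu : LipschitzWith (L + L) (fun y => w y - h y) := hw.sub hh
  have hu0 : ∀ x ∈ Ω, 0 ≤ w x - h x := fun x hx => sub_nonneg.2
    (max_le (by linarith [(abs_le.1 (hwv x hx)).1]) (hwnn x hx))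
  have hu1 : ∀ x ∈ Ω, w x - h x ≤ 2 * ε := fun x hx => by
    linarith [(abs_le.1 (hwv x hx)).2, le_max_left (v x - ε) 0]
  have huS : ∀ x ∈ Ω, |w x - h x| ≤ 2 * ε := fun x hx =>
    (abs_of_nonneg (hu0 x hx)).trans_le (hu1 x hx)
  have hη1' : ∀ x, |η x| ≤ 1 := fun x => (abs_of_nonneg (hη0 x)).trans_le (hη1 x)
  have hηn : ∀ x ∉ Ω, η x = 0 := fun x hx => image_eq_zero_of_notMem_tsupport fun h => hx (hηΩ h)
  have hφ := hη.cutoff_mul (S := ⟨2 * ε, by positivity⟩) hη1' hηn hu huS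
  have hsub : tsupport (fun x => η x * (w x - h x)) ⊆ tsupport η :=
    closure_mono (Function.support_mul_subset_left _ _)
  have h1 := abs_integral_inner_gradient_le_of_posSet hF hΩ hw.continuous hM htest hφ
    (hηc.isCompact.of_isClosed_subset (isClosed_tsupport _) hsub) (hsub.trans hηΩ)
    (fun x => by
      by_cases hx : x ∈ Ω
      · exact mul_nonneg (hη0 x) (hu0 x hx)
      · simp [hηn x hx])
    (fun x hx => by
      have h0 : 0 ≤ h x := le_max_right _ _
      linarith [pos_of_mul_pos_right hx (hη0 x)])
    (S := 2 * ε)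
    (fun x => by
      by_cases hx : x ∈ Ω
      · nlinarith [hη0 x, hη1 x, hu0 x hx, hu1 x hx]
      · simp [hηn x hx, hε])
  rw [integral_inner_gradient_mul hF hF0 hη hη1' hu huS] at h1
  have h2 := abs_integral_mul_inner_gradient_le hF hF0 hη huS
  have h3 : ∫ x, η x * ⟪F x, gradient w x - gradient h x⟫ =
      ∫ x, η x * ⟪F x, gradient (fun y => w y - h y) x⟫ := by
    refine integral_congr_ae ?_
    filter_upwards [hw.ae_differentiableAt, hh.ae_differentiableAt] with x h1 h2
    rw [gradient_fun_sub h1 h2]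
  rw [h3]
  rw [abs_le] at h1 h2 ⊢
  constructor <;> linarith

theorem tendsto_integral_cutoff_mul_inner_gradient {F : E → E} (hF : Integrable F) {Ω : Set E}
    (hF0 : ∀ x ∉ Ω, F x = 0) {η : E → ℝ} {C L : ℝ≥0} (hη : LipschitzWith C η)
    (hη1 : ∀ x, |η x| ≤ 1) (hη0 : ∀ x ∉ Ω, η x = 0) {u : ℕ → E → ℝ}
    (hu : ∀ k, LipschitzWith L (u k)) (hlim : TendstoUniformlyOn u 0 atTop Ω) :
    Tendsto (fun k => ∫ x, η x * ⟪F x, gradient (u k) x⟫) atTop (𝓝 0) := by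
  have hsmall : ∀ ε > 0, ∀ᶠ k in atTop, ∀ x ∈ Ω, |u k x| < ε := fun ε hε => by
    filter_upwards [Metric.tendstoUniformlyOn_iff.1 hlim ε hε] with k hk x hx
    simpa using hk x hx
  obtain ⟨N, hN⟩ := eventually_atTop.1 (hsmall 1 one_pos)
  rw [← tendsto_add_atTop_iff_nat N]
  have hb : ∀ k, ∀ x ∈ Ω, |u (k + N) x| ≤ (1 : ℝ≥0) := fun k x hx =>
    (hN (k + N) (Nat.le_add_left _ _) x hx).le
  have hψ : TendstoUniformly (fun k x => η x * u (k + N) x) 0 atTop := by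
    rw [Metric.tendstoUniformly_iff]
    intro ε hε
    filter_upwards [(tendsto_add_atTop_nat N).eventually (hsmall ε hε)] with k hk x
    rw [Pi.zero_apply, dist_zero_left]
    by_cases hx : x ∈ Ω
    · rw [norm_mul]
      exact (mul_le_of_le_one_left (norm_nonneg _) (hη1 x)).trans_lt (hk x hx)
    · simpa [hη0 x hx] using hε
  have h1 := tendsto_integral_inner_gradient hF
    (fun k => hη.cutoff_mul hη1 hη0 (hu (k + N)) (hb k)) hψ
  have h2 : Tendsto (fun k => ∫ x, u (k + N) x * ⟪F x, gradient η x⟫) atTop (𝓝 0) := by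
    rw [Metric.tendsto_atTop]
    intro ε hε
    set I := (C : ℝ) * ∫ x, ‖F x‖ with hI
    have hI0 : 0 ≤ I := by positivity
    obtain ⟨n, hn⟩ := eventually_atTop.1 ((tendsto_add_atTop_nat N).eventually
      (hsmall (ε / (I + 1)) (by positivity)))
    refine ⟨n, fun k hk => ?_⟩
    rw [dist_zero_right]
    refine (abs_integral_mul_inner_gradient_le hF hF0 hη
      (fun x hx => (hn k hk x hx).le)).trans_lt ?_
    rw [← hI, div_mul_eq_mul_div, div_lt_iff₀ (by positivity)]
    nlinarith
  have h3 := h1.sub h2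
  rw [sub_zero] at h3
  refine h3.congr fun k => ?_
  rw [integral_inner_gradient_mul hF hF0 hη hη1 (hu _) (hb k)]
  ring

/-- Convergence of the localized energy of the difference, for uniformly Lipschitz nonnegative
functions which are almost solutions on their positivity sets. -/
theorem tendsto_integral_cutoff_energy_sub {Ω : Set E} (hΩ : IsOpen Ω)
    (hΩfin : volume Ω ≠ ⊤) {B : E → E →L[ℝ] E} (hB : StronglyMeasurable B) {Q : ℝ}
    (hBQ : ∀ x, ‖B x‖ ≤ Q) (hB0 : ∀ x ∉ Ω, B x = 0) {M : ℝ} (hM : 0 ≤ M)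
    {η v : E → ℝ} {w : ℕ → E → ℝ} {C L : ℝ≥0} (hη : LipschitzWith C η)
    (hηc : HasCompactSupport η) (hηΩ : tsupport η ⊆ Ω) (hη0 : ∀ x, 0 ≤ η x)
    (hη1 : ∀ x, η x ≤ 1) (hw : ∀ k, LipschitzWith L (w k)) (hv : LipschitzWith L v)
    (hwnn : ∀ k, ∀ x ∈ Ω, 0 ≤ w k x) (hvnn : ∀ x ∈ Ω, 0 ≤ v x)
    (hlim : TendstoUniformlyOn w v atTop Ω)
    (htest : ∀ k, ∀ ψ : E → ℝ, ContDiff ℝ (⊤ : ℕ∞) ψ → HasCompactSupport ψ →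
      tsupport ψ ⊆ Ω ∩ {x | 0 < w k x} → ∀ S, (∀ x, |ψ x| ≤ S) →
        |∫ x, ⟪B x (gradient (w k) x), gradient ψ x⟫| ≤ M * S) :
    Tendsto (fun k => ∫ x, η x * ⟪B x (gradient (w k) x - gradient v x),
      gradient (w k) x - gradient v x⟫) atTop (𝓝 0) := by
  have hQ : 0 ≤ Q := (norm_nonneg _).trans (hBQ 0)
  have hη1' : ∀ x, |η x| ≤ 1 := fun x => (abs_of_nonneg (hη0 x)).trans_le (hη1 x)
  have hηn : ∀ x ∉ Ω, η x = 0 := fun x hx => image_eq_zero_of_notMem_tsupport fun h => hx (hηΩ h)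
  have hbd : ∀ {f : E → ℝ}, LipschitzWith L f → ∀ x,
      ‖B x (gradient f x)‖ ≤ Ω.indicator (fun _ => Q * L) x := by
    intro f hf x
    by_cases hx : x ∈ Ω
    · rw [indicator_of_mem hx]
      exact ((B x).le_opNorm _).trans
        (mul_le_mul (hBQ x) (hf.norm_gradient_le x) (norm_nonneg _) hQ)
    · simp [hx, hB0 x hx]
  have hbdi : Integrable (Ω.indicator fun _ => Q * (L : ℝ)) :=
    (integrable_indicator_iff hΩ.measurableSet).2 (integrableOn_const hΩfin)
  have hBm : ∀ f : E → ℝ, StronglyMeasurable fun x => B x (gradient f x) := fun f =>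
    (isBoundedBilinearMap_apply (𝕜 := ℝ) (E := E) (F := E)).continuous.comp_stronglyMeasurable
      (hB.prodMk (measurable_gradient f).stronglyMeasurable)
  have hFi : ∀ {f : E → ℝ}, LipschitzWith L f → Integrable fun x => B x (gradient f x) :=
    fun hf => hbdi.mono' (hBm _).aestronglyMeasurable (.of_forall (hbd hf))
  set V := ∫ x, Ω.indicator (fun _ => Q * (L : ℝ)) x
  have hFV : ∀ {f : E → ℝ}, LipschitzWith L f → ∫ x, ‖B x (gradient f x)‖ ≤ V := fun hf =>
    integral_mono (hFi hf).norm hbdi (hbd hf)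
  set h : ℝ → E → ℝ := fun ε y => max (v y - ε) 0
  have hhL : ∀ ε, LipschitzWith L (h ε) := fun ε => hv.max_sub_const ε
  set R : ℝ → ℝ := fun ε => ∫ x, Ω.indicator (fun _ => Q * (L : ℝ)) x *
    ‖gradient (h ε) x - gradient v x‖
  have hRi : ∀ ε, Integrable fun x => Ω.indicator (fun _ => Q * (L : ℝ)) x *
      ‖gradient (h ε) x - gradient v x‖ := fun ε =>
    hbdi.mul_bdd ((measurable_gradient _).sub (measurable_gradient _)).norm.aestronglyMeasurable
      (c := L + L) (.of_forall fun x => by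
        rw [norm_norm]
        exact (norm_sub_le _ _).trans
          (add_le_add ((hhL ε).norm_gradient_le x) (hv.norm_gradient_le x)))
  have hRlim : Tendsto R (𝓝[>] 0) (𝓝 0) := by
    rw [show (0 : ℝ) = ∫ _ : E, (0 : ℝ) by simp]
    refine tendsto_integral_filter_of_dominated_convergence
      (fun x => Ω.indicator (fun _ => Q * (L : ℝ)) x * (L + L))
      (.of_forall fun ε => (hRi ε).1) (.of_forall fun ε => .of_forall fun x => ?_)
      (hbdi.mul_const _) (.of_forall fun x => ?_)
    · rw [norm_mul, norm_norm,
        Real.norm_of_nonneg (indicator_nonneg (fun _ _ => by positivity) x)]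
      refine mul_le_mul_of_nonneg_left ((norm_sub_le _ _).trans
          (add_le_add ((hhL ε).norm_gradient_le x) (hv.norm_gradient_le x)))
        (indicator_nonneg (fun _ _ => by positivity) x)
    · by_cases hx : x ∈ Ω
      · have := tendsto_gradient_max_sub_zero hv.continuous.continuousAt
          (eventually_of_mem (hΩ.mem_nhds hx) hvnn)
        simp only [indicator_of_mem hx]
        simpa using ((this.sub_const (gradient v x)).norm).const_mul (Q * (L : ℝ))
      · simp [hx]
  have hweak : Tendsto (fun k => ∫ x, η x * ⟪B x (gradient v x),
      gradient (fun y => w k y - v y) x⟫) atTop (𝓝 0) := by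
    refine tendsto_integral_cutoff_mul_inner_gradient (hFi hv)
      (fun x hx => by simp [hB0 x hx]) hη hη1' hηn (fun k => (hw k).sub hv) ?_
    rw [Metric.tendstoUniformlyOn_iff] at hlim ⊢
    intro ε hε
    filter_upwards [hlim ε hε] with k hk x hx
    simpa [Real.dist_eq, abs_sub_comm] using hk x hx
  have hsplit : ∀ k ε, ∫ x, η x * ⟪B x (gradient (w k) x - gradient v x),
      gradient (w k) x - gradient v x⟫ =
      (∫ x, η x * ⟪B x (gradient (w k) x), gradient (w k) x - gradient (h ε) x⟫) +
      (∫ x, η x * ⟪B x (gradient (w k) x), gradient (h ε) x - gradient v x⟫) -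
      ∫ x, η x * ⟪B x (gradient v x), gradient (fun y => w k y - v y) x⟫ := by
    intro k ε
    have hint : ∀ {f g : E → ℝ}, LipschitzWith L f → LipschitzWith L g →
        Integrable fun x => η x * ⟪B x (gradient f x), gradient g x⟫ := fun hf hg =>
      (integrable_inner_gradient (hFi hf) hg).bdd_mul hη.continuous.aestronglyMeasurable
        (.of_forall hη1')
    have hint' : ∀ {f g g' : E → ℝ}, LipschitzWith L f → LipschitzWith L g →
        LipschitzWith L g' →
        Integrable fun x => η x * ⟪B x (gradient f x), gradient g x - gradient g' x⟫ :=
      fun hf hg hg' => by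
        simp only [inner_sub_right, mul_sub]
        exact (hint hf hg).sub (hint hf hg')
    have hcongr : ∫ x, η x * ⟪B x (gradient v x), gradient (fun y => w k y - v y) x⟫ =
        ∫ x, η x * ⟪B x (gradient v x), gradient (w k) x - gradient v x⟫ := by
      refine integral_congr_ae ?_
      filter_upwards [(hw k).ae_differentiableAt, hv.ae_differentiableAt] with x h1 h2
      rw [gradient_fun_sub h1 h2]
    have hadd : Integrable fun x =>
        η x * ⟪B x (gradient (w k) x), gradient (w k) x - gradient (h ε) x⟫ +
          η x * ⟪B x (gradient (w k) x), gradient (h ε) x - gradient v x⟫ :=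
      (hint' (hw k) (hw k) (hhL ε)).add (hint' (hw k) (hhL ε) hv)
    rw [hcongr, ← integral_add (hint' (hw k) (hw k) (hhL ε)) (hint' (hw k) (hhL ε) hv),
      ← integral_sub hadd (hint' hv (hw k) hv)]
    refine integral_congr_ae (.of_forall fun x => ?_)
    simp only [inner_sub_right, inner_sub_left, map_sub]
    ring
  rw [Metric.tendsto_atTop']
  intro e he
  have hε : ∀ᶠ ε in 𝓝[>] (0 : ℝ), 2 * ε * (M + C * V) + R ε < e / 2 := by
    have : Tendsto (fun ε : ℝ => 2 * ε * (M + C * V) + R ε) (𝓝[>] 0)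
        (𝓝 (2 * 0 * (M + C * V) + 0)) :=
      (((tendsto_id.mono_left nhdsWithin_le_nhds).const_mul 2).mul_const _).add hRlim
    refine this.eventually (gt_mem_nhds ?_)
    simpa using half_pos he
  obtain ⟨ε, hεe, hε0 : 0 < ε⟩ := (hε.and self_mem_nhdsWithin).exists
  obtain ⟨N, hN⟩ := eventually_atTop.1 ((Metric.tendstoUniformlyOn_iff.1 hlim ε hε0).and
    (Metric.tendsto_nhds.1 hweak (e / 2) (half_pos he)))
  refine ⟨N, fun k hk => ?_⟩
  obtain ⟨hk1, hk2⟩ := hN k hk.le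
  have h1 := abs_integral_cutoff_mul_inner_gradient_sub_le (hFi (hw k)) hΩ
    (fun x hx => by simp [hB0 x hx]) hM hη hηc hηΩ hη0 hη1 (hw k) hv (hwnn k) (htest k) hε0.le
    (fun x hx => by simpa [Real.dist_eq, abs_sub_comm] using (hk1 x hx).le)
  have h1' : 2 * ε * (M + C * ∫ x, ‖B x (gradient (w k) x)‖) ≤ 2 * ε * (M + C * V) := by
    gcongr
    exact hFV (hw k)
  have h2 : |∫ x, η x * ⟪B x (gradient (w k) x), gradient (h ε) x - gradient v x⟫| ≤ R ε := by
    rw [← Real.norm_eq_abs]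
    refine norm_integral_le_of_norm_le (hRi ε) (.of_forall fun x => ?_)
    rw [norm_mul]
    refine (mul_le_of_le_one_left (norm_nonneg _) (hη1' x)).trans
      ((norm_inner_le_norm _ _).trans ?_)
    gcongr
    exact hbd (hw k) x
  rw [dist_zero_right, Real.norm_eq_abs] at hk2 ⊢
  rw [hsplit k ε]
  rw [abs_lt] at hk2 ⊢
  rw [abs_le] at h1 h2
  constructor <;> linarith [h1.1, h1.2, h2.1, h2.2, hk2.1, hk2.2]

end GradientTools

/-- `L²` convergence of bounded functions implies convergence of the integrals of their squared
norms against any integrable weight. -/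
theorem tendsto_integral_sq_norm_mul_of_tendsto_integral_sq_norm_sub {α G : Type*}
    [MeasurableSpace α] {μ : Measure α} [NormedAddCommGroup G] {f : ℕ → α → G} {f₀ : α → G}
    {W : α → ℝ} {L : ℝ} (hf : ∀ k, AEStronglyMeasurable (f k) μ)
    (hint : ∀ k, Integrable (fun x => ‖f k x - f₀ x‖ ^ 2) μ) (hL : ∀ k x, ‖f k x‖ ≤ L)
    (hW : Integrable W μ)
    (hlim : Tendsto (fun k => ∫ x, ‖f k x - f₀ x‖ ^ 2 ∂μ) atTop (𝓝 0)) :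
    Tendsto (fun k => ∫ x, ‖f k x‖ ^ 2 * W x ∂μ) atTop (𝓝 (∫ x, ‖f₀ x‖ ^ 2 * W x ∂μ)) := by
  have hmeas : TendstoInMeasure μ (fun k x => ‖f k x - f₀ x‖ ^ 2) atTop fun _ => 0 := by
    refine tendstoInMeasure_of_tendsto_eLpNorm one_ne_zero (fun k => (hint k).1)
      aestronglyMeasurable_const ?_
    have : ∀ k, eLpNorm ((fun x => ‖f k x - f₀ x‖ ^ 2) - fun _ => (0 : ℝ)) 1 μ =
        ENNReal.ofReal (∫ x, ‖f k x - f₀ x‖ ^ 2 ∂μ) := by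
      intro k
      rw [show ((fun x => ‖f k x - f₀ x‖ ^ 2) - fun _ => (0 : ℝ)) =
        fun x => ‖f k x - f₀ x‖ ^ 2 by ext x; simp, eLpNorm_one_eq_lintegral_enorm,
        ← ofReal_integral_norm_eq_lintegral_enorm (hint k)]
      simp
    simp_rw [this]
    simpa using ENNReal.tendsto_ofReal hlim
  refine tendsto_of_subseq_tendsto fun ns hns => ?_
  have hsub : TendstoInMeasure μ (fun k x => ‖f (ns k) x - f₀ x‖ ^ 2) atTop fun _ => 0 :=
    fun ε hε => (hmeas ε hε).comp hns
  obtain ⟨ms, -, hms⟩ := hsub.exists_seq_tendsto_ae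
  refine ⟨ms, tendsto_integral_of_dominated_convergence (fun x => L ^ 2 * ‖W x‖)
    (fun k => ((hf _).norm.pow 2).mul hW.1) (hW.norm.const_mul _)
    (fun k => .of_forall fun x => ?_) ?_⟩
  · rw [norm_mul, norm_pow, norm_norm]
    gcongr
    exact hL _ x
  · filter_upwards [hms] with x hx
    have h1 : Tendsto (fun k => ‖f (ns (ms k)) x - f₀ x‖) atTop (𝓝 0) := by
      simpa [Real.sqrt_sq] using hx.sqrt
    exact (((tendsto_iff_norm_sub_tendsto_zero.2 h1).norm.pow 2).mul_const _)

theorem integrableOn_inv_norm_rpow_ball {n : ℕ} (hn : 2 ≤ n) :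
    IntegrableOn (fun x : EucSp n => (‖x‖ ^ ((n : ℝ) - 2))⁻¹) (ball 0 1) := by
  have : Nonempty (Fin n) := ⟨⟨0, by omega⟩⟩
  rw [integrableOn_fun_norm_addHaar volume (f := fun r : ℝ => (r ^ ((n : ℝ) - 2))⁻¹)]
  have hid : IntegrableOn (fun y : ℝ => y) (Ioo 0 1) :=
    (continuous_id.integrableOn_Icc (a := (0 : ℝ)) (b := 1)).mono_set Ioo_subset_Icc_self
  refine hid.congr_fun (fun y hy => ?_) measurableSet_Ioo
  have h2 : ((n : ℝ) - 2) = ((n - 2 : ℕ) : ℝ) := by push_cast [hn]; ring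
  simp only [finrank_euclideanSpace, Fintype.card_fin, h2, Real.rpow_natCast, smul_eq_mul]
  rw [show n - 1 = (n - 2) + 1 by omega, pow_succ]
  field_simp [hy.1.ne']

theorem HolderSemi.continuousOn {n : ℕ} {A : EucSp n → (EucSp n →L[ℝ] EucSp n)} {γ K : ℝ}
    {s : Set (EucSp n)} (h : HolderSemi A γ K s) (hγ : 0 < γ) : ContinuousOn A s := by
  intro x hx
  refine tendsto_iff_norm_sub_tendsto_zero.2 ?_
  refine squeeze_zero' (.of_forall fun _ => norm_nonneg _)
    (eventually_of_mem self_mem_nhdsWithin fun y hy => h y hy x hx) ?_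
  have : Continuous fun y => K * ‖y - x‖ ^ γ :=
    continuous_const.mul ((continuous_id.sub continuous_const).norm.rpow_const fun _ => .inr hγ.le)
  have h0 := (this.tendsto x).mono_left (nhdsWithin_le_nhds (s := s))
  simpa [Real.zero_rpow hγ.ne'] using h0

theorem LipschitzOnWith.of_tendsto {X : Type*} [PseudoMetricSpace X] {s : Set X} {L : ℝ≥0}
    {f : ℕ → X → ℝ} {f₀ : X → ℝ} (hf : ∀ k, LipschitzOnWith L (f k) s)
    (hlim : ∀ x ∈ s, Tendsto (fun k => f k x) atTop (𝓝 (f₀ x))) : LipschitzOnWith L f₀ s :=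
  LipschitzOnWith.of_dist_le_mul fun x hx y hy =>
    le_of_tendsto' ((hlim x hx).dist (hlim y hy)) fun k => (hf k).dist_le_mul x hx y hy

/-- Bounded weak sources control the weak operator on test functions of the positivity set. -/
theorem WeakEq.abs_integral_inner_gradient_le {n : ℕ} {A : EucSp n → (EucSp n →L[ℝ] EucSp n)}
    {Ω : Set (EucSp n)} (hΩ : IsOpen Ω) (hΩfin : volume Ω ≠ ⊤) {u g w : EucSp n → ℝ} {M : ℝ}
    (hM : 0 ≤ M) (hg : ∀ x ∈ Ω, |g x| ≤ M) (huw : EqOn u w Ω)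
    (heq : WeakEq A u g (Ω ∩ {x | 0 < u x})) {ψ : EucSp n → ℝ} (hψ : ContDiff ℝ (⊤ : ℕ∞) ψ)
    (hψc : HasCompactSupport ψ) (hψs : tsupport ψ ⊆ Ω ∩ {x | 0 < w x}) {S : ℝ}
    (hS : ∀ x, |ψ x| ≤ S) :
    |∫ x, ⟪Ω.indicator A x (gradient w x), gradient ψ x⟫| ≤ M * volume.real Ω * S := by
  have hS0 : 0 ≤ S := (abs_nonneg _).trans (hS 0)
  have hset : Ω ∩ {x | 0 < u x} = Ω ∩ {x | 0 < w x} := by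
    ext x
    exact and_congr_right fun hx => by rw [Set.mem_ofPred, Set.mem_ofPred, huw hx]
  have h := heq ψ ⟨hψ, hψc, hset ▸ hψs⟩
  have h1 : ∫ x, ⟪Ω.indicator A x (gradient w x), gradient ψ x⟫ =
      ∫ x in Ω ∩ {x | 0 < u x}, ⟪A x (gradient u x), gradient ψ x⟫ := by
    have h2 : ∀ x, ⟪Ω.indicator A x (gradient w x), gradient ψ x⟫ =
        ⟪A x (gradient u x), gradient ψ x⟫ := by
      intro x
      by_cases hx : x ∈ tsupport ψ
      · have hxΩ := (hψs hx).1
        rw [indicator_of_mem hxΩ, (huw.eventuallyEq_of_mem (hΩ.mem_nhds hxΩ)).gradient_eq]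
      · simp [gradient_eq_zero_of_notMem_tsupport hx]
    simp_rw [h2]
    refine (setIntegral_eq_integral_of_forall_compl_eq_zero fun x hx => ?_).symm
    rw [gradient_eq_zero_of_notMem_tsupport fun hx' => hx (hset ▸ hψs hx'), inner_zero_right]
  rw [h1, h, abs_neg, ← Real.norm_eq_abs]
  refine (norm_setIntegral_le_of_norm_le_const (C := M * S)
    ((measure_mono inter_subset_left).trans_lt hΩfin.lt_top) fun x hx => ?_).trans ?_
  · rw [norm_mul]
    exact mul_le_mul (hg x hx.1) (hS x) (norm_nonneg _) hM
  · rw [mul_right_comm]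
    gcongr
    exact inter_subset_left

/-- **Lemma 6.1.** Convergence of the weighted Dirichlet integrals under
uniform convergence. -/
theorem weighted_dirichlet_convergence
    {n : ℕ} (hn : 2 ≤ n)
    (A : EucSp n → (EucSp n →L[ℝ] EucSp n)) (γ lam Lam K : ℝ)
    (hγ : γ ∈ Set.Ioo (0:ℝ) 1) (hlam : 0 < lam) (hlamLam : lam ≤ Lam) (hK : 0 < K)
    (hell : IsElliptic A lam Lam (ball 0 2)) (hsym : IsSymmCoeff A (ball 0 2))
    (hhold : HolderSemi A γ K (ball 0 2))
    (v : ℕ → EucSp n → ℝ) (vlim : EucSp n → ℝ)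
    (hnn : ∀ k, ∀ x ∈ ball (0 : EucSp n) 2, 0 ≤ v k x)
    (L : ℝ≥0) (hLip : ∀ k, LipschitzOnWith L (v k) (ball 0 2))
    (g : ℕ → EucSp n → ℝ) (M : ℝ)
    (hg : ∀ k, ∀ x ∈ ball (0 : EucSp n) 2, |g k x| ≤ M)
    (heq : ∀ k, WeakEq A (v k) (g k) (ball 0 2 ∩ {x | 0 < v k x}))
    (hconv : TendstoUniformlyOn (fun k => v k) vlim atTop (ball 0 2)) :
    Tendsto
      (fun k => ∫ x in ball (0 : EucSp n) 1, ‖gradient (v k) x‖ ^ 2 / ‖x‖ ^ ((n:ℝ) - 2))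
      atTop
      (𝓝 (∫ x in ball (0 : EucSp n) 1, ‖gradient vlim x‖ ^ 2 / ‖x‖ ^ ((n:ℝ) - 2))) := by
  set Ω : Set (EucSp n) := ball 0 2
  have hΩ : IsOpen Ω := isOpen_ball
  have hΩfin : volume Ω ≠ ⊤ := measure_ball_lt_top.ne
  have h0Ω : (0 : EucSp n) ∈ Ω := mem_ball_self two_pos
  have hM : 0 ≤ M := (abs_nonneg _).trans (hg 0 0 h0Ω)
  have hpt : ∀ x ∈ Ω, Tendsto (fun k => v k x) atTop (𝓝 (vlim x)) := fun x hx =>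
    hconv.tendsto_at hx
  obtain ⟨w₀, hw₀, hw₀v⟩ := (LipschitzOnWith.of_tendsto hLip hpt).extend_real
  choose w hw hwv using fun k => (hLip k).extend_real
  have hBQ : ∀ x, ‖Ω.indicator A x‖ ≤ ‖A 0‖ + K * 2 ^ γ := by
    intro x
    by_cases hx : x ∈ Ω
    · rw [indicator_of_mem hx]
      have h1 := hhold x hx 0 h0Ω
      rw [sub_zero] at h1
      have h2 : ‖x‖ ^ γ ≤ 2 ^ γ :=
        Real.rpow_le_rpow (norm_nonneg _) (mem_ball_zero_iff.1 hx).le hγ.1.le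
      calc ‖A x‖ = ‖A 0 + (A x - A 0)‖ := by rw [add_sub_cancel]
        _ ≤ ‖A 0‖ + ‖A x - A 0‖ := norm_add_le _ _
        _ ≤ ‖A 0‖ + K * 2 ^ γ := by gcongr; exact h1.trans (by gcongr)
    · rw [indicator_of_notMem hx, norm_zero]
      positivity
  have hB : StronglyMeasurable (Ω.indicator A) := by
    classical
    have h := (hhold.continuousOn hγ.1).measurable_piecewise
      (continuousOn_const (c := (0 : EucSp n →L[ℝ] EucSp n)) (s := Ωᶜ)) hΩ.measurableSet
    exact (piecewise_eq_indicator (s := Ω) (f := A) ▸ h).stronglyMeasurable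
  let η : ContDiffBump (0 : EucSp n) := ⟨1, 3 / 2, one_pos, by norm_num⟩
  obtain ⟨C, hη⟩ := (η.contDiff (n := 1)).lipschitzWith_of_hasCompactSupport
    η.hasCompactSupport one_ne_zero
  have hηΩ : tsupport η ⊆ Ω := by
    rw [η.tsupport_eq]
    exact closedBall_subset_ball (by norm_num)
  have hlim : TendstoUniformlyOn w w₀ atTop Ω :=
    (hconv.congr (.of_forall hwv)).congr_right hw₀v
  have henergy := tendsto_integral_cutoff_energy_sub hΩ hΩfin hB hBQ
    (fun x hx => indicator_of_notMem hx _) (M := M * volume.real Ω) (by positivity) hη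
    η.hasCompactSupport hηΩ (fun _ => η.nonneg) (fun _ => η.le_one) hw hw₀
    (fun k x hx => hwv k hx ▸ hnn k x hx)
    (fun x hx => hw₀v hx ▸ ge_of_tendsto' (hpt x hx) fun k => hnn k x hx) hlim
    (fun k ψ hψ hψc hψs S hS =>
      (heq k).abs_integral_inner_gradient_le hΩ hΩfin hM (hg k) (hwv k) hψ hψc hψs hS)
  have : IsFiniteMeasure (volume.restrict (ball (0 : EucSp n) 1)) :=
    isFiniteMeasure_restrict.2 measure_ball_lt_top.ne
  have hdiff : ∀ k x, ‖gradient (w k) x - gradient w₀ x‖ ≤ L + L := fun k x =>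
    (norm_sub_le _ _).trans (add_le_add ((hw k).norm_gradient_le x) (hw₀.norm_gradient_le x))
  have hdm : ∀ k, StronglyMeasurable fun x => gradient (w k) x - gradient w₀ x := fun k =>
    ((measurable_gradient _).sub (measurable_gradient _)).stronglyMeasurable
  have hsq : ∀ k, Integrable (fun x => ‖gradient (w k) x - gradient w₀ x‖ ^ 2)
      (volume.restrict (ball (0 : EucSp n) 1)) := fun k =>
    Integrable.of_bound ((hdm k).norm.pow 2).aestronglyMeasurable ((L + L : ℝ) ^ 2)
      (.of_forall fun x => by
        rw [norm_pow, norm_norm]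
        gcongr
        exact hdiff k x)
  have hL2 : Tendsto (fun k => ∫ x in ball (0 : EucSp n) 1,
      ‖gradient (w k) x - gradient w₀ x‖ ^ 2) atTop (𝓝 0) := by
    have h0 := henergy.const_mul lam⁻¹
    rw [mul_zero] at h0
    refine squeeze_zero (fun k => integral_nonneg fun x => by positivity) (fun k => ?_) h0
    rw [← integral_const_mul, ← integral_indicator measurableSet_ball]
    refine integral_mono ((integrable_indicator_iff measurableSet_ball).2 (hsq k)) ?_ fun x => ?_
    · have hm : StronglyMeasurable fun x => η x * ⟪Ω.indicator A x
          (gradient (w k) x - gradient w₀ x), gradient (w k) x - gradient w₀ x⟫ :=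
        η.continuous.stronglyMeasurable.mul
          (((isBoundedBilinearMap_apply (𝕜 := ℝ)).continuous.comp_stronglyMeasurable
            (hB.prodMk (hdm k))).inner (hdm k))
      refine (((integrable_indicator_iff hΩ.measurableSet).2 (integrableOn_const hΩfin
        (C := (‖A 0‖ + K * 2 ^ γ) * (L + L) * (L + L)))).mono' hm.aestronglyMeasurable
        (.of_forall fun x => ?_)).const_mul _
      by_cases hx : x ∈ Ω
      · rw [norm_mul, Real.norm_of_nonneg η.nonneg]
        refine (mul_le_of_le_one_left (norm_nonneg _) η.le_one).trans
          ((norm_inner_le_norm _ _).trans ?_)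
        have h1 := (Ω.indicator A x).le_of_opNorm_le_of_le (hBQ x) (hdiff k x)
        rw [indicator_of_mem hx (f := fun _ => (‖A 0‖ + K * 2 ^ γ) * (L + L) * (L + L))]
        exact mul_le_mul h1 (hdiff k x) (norm_nonneg _) (by positivity)
      · simp [hx]
    · have hell' : ∀ x ∈ Ω, ∀ ξ : EucSp n, ‖ξ‖ ^ 2 ≤ lam⁻¹ * ⟪Ω.indicator A x ξ, ξ⟫ := by
        intro x hx ξ
        rw [indicator_of_mem hx, inv_mul_eq_div, le_div_iff₀' hlam]
        exact (hell x hx ξ).1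
      by_cases hx : x ∈ Ω
      · have h1 := hell' x hx (gradient (w k) x - gradient w₀ x)
        dsimp only
        rw [mul_left_comm]
        by_cases hx1 : x ∈ ball (0 : EucSp n) 1
        · rwa [indicator_of_mem hx1, η.one_of_mem_closedBall (ball_subset_closedBall hx1), one_mul]
        · rw [indicator_of_notMem hx1]
          exact mul_nonneg η.nonneg ((sq_nonneg _).trans h1)
      · have hx1 : x ∉ ball (0 : EucSp n) 1 := fun h => hx (ball_subset_ball one_le_two h)
        simp [hx, hx1]
  have hmain := tendsto_integral_sq_norm_mul_of_tendsto_integral_sq_norm_sub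
    (fun k => (measurable_gradient (w k)).aestronglyMeasurable) hsq
    (fun k x => (hw k).norm_gradient_le x) (integrableOn_inv_norm_rpow_ball hn) hL2
  have hcongr : ∀ {u u' : EucSp n → ℝ}, EqOn u u' Ω →
      ∫ x in ball (0 : EucSp n) 1, ‖gradient u' x‖ ^ 2 * (‖x‖ ^ ((n : ℝ) - 2))⁻¹ =
        ∫ x in ball (0 : EucSp n) 1, ‖gradient u x‖ ^ 2 / ‖x‖ ^ ((n : ℝ) - 2) := by
    intro u u' huu
    refine setIntegral_congr_fun measurableSet_ball fun x hx => ?_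
    have hxΩ : x ∈ Ω := ball_subset_ball one_le_two hx
    rw [div_eq_mul_inv, (huu.eventuallyEq_of_mem (hΩ.mem_nhds hxΩ)).gradient_eq]
  rw [hcongr hw₀v] at hmain
  exact hmain.congr fun k => hcongr (hwv k)
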